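/- High-order boundary vanishing modulo gauge: let f₀, f₁, …, f_{n−1} be real-valued functions on [0,ε) × U that extend to C^∞ functions on an open neighborhood of [0,ε) × U in ℝ × ℝ^{n-1} (the components of a smooth one-form f = f₀ dx + Σ_i f_i dy^i). Suppose there exists s₀ > 0 such that (i) for every y₀ ∈ U, every η₀ ∈ ℝ^{n-1} with ⟨A(0,y₀)η₀, η₀⟩ = 1, and every s ∈ (0,s₀) there exists a short-geodesic trajectory with data (y₀, η₀, s), and (ii) every such short-geodesic trajectory satisfies ∫₀^T [f₀(x(t),y(t)) ξ(t) + Σ_{i=1}^{n-1} f_i(x(t),y(t)) (x(t)² A(x(t),y(t)) η(t))_i] dt = 0. Then there exists a function q on [0,ε) × U, extending to a C^∞ function on an open neighborhood of [0,ε) × U, with q(0,y) = 0 for all y ∈ U, such that ∂_x^k (f₀ − ∂_x q)(0,y) = 0 and ∂_x^k (f_i − ∂_{y_i} q)(0,y) = 0 for every integer k ≥ 0, every i = 1,…,n−1, and every y ∈ U; that is, f − dq vanishes to infinite order at the boundary x = 0. -/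

import Mathlib

open Set

noncomputable section

/-- `quadForm M v w = ⟨M v, w⟩`, the bilinear form of the matrix `M` with respect to the
standard inner product on `ℝ^m`. -/
def quadForm {m : ℕ} (M : Matrix (Fin m) (Fin m) ℝ) (v w : Fin m → ℝ) : ℝ :=
  ∑ i, (∑ j, M i j * v j) * w i

/-- The Euclidean norm of a vector in `ℝ^m`. -/
def euclNorm {m : ℕ} (v : Fin m → ℝ) : ℝ :=
  Real.sqrt (∑ i, v i ^ 2)

/-- Entrywise partial derivative `∂ₓ A` of a matrix-valued map in its first (scalar) variable. -/
def dxA {m : ℕ} (A : ℝ → (Fin m → ℝ) → Matrix (Fin m) (Fin m) ℝ)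
    (x : ℝ) (y : Fin m → ℝ) : Matrix (Fin m) (Fin m) ℝ :=
  Matrix.of fun i j => deriv (fun x' => A x' y i j) x

/-- Entrywise partial derivative `∂_{y k} A` of a matrix-valued map in the `k`-th component of
its second (vector) variable. -/
def dyA {m : ℕ} (A : ℝ → (Fin m → ℝ) → Matrix (Fin m) (Fin m) ℝ)
    (k : Fin m) (x : ℝ) (y : Fin m → ℝ) : Matrix (Fin m) (Fin m) ℝ :=
  Matrix.of fun i j => deriv (fun s => A x (Function.update y k s) i j) (y k)

/-- Partial derivative `∂ₓ f` of a scalar function of `(x, y)`. -/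
def dxF {m : ℕ} (f : ℝ → (Fin m → ℝ) → ℝ) (x : ℝ) (y : Fin m → ℝ) : ℝ :=
  deriv (fun x' => f x' y) x

/-- Partial derivative `∂_{y k} f` of a scalar function of `(x, y)`. -/
def dyF {m : ℕ} (f : ℝ → (Fin m → ℝ) → ℝ) (k : Fin m) (x : ℝ) (y : Fin m → ℝ) : ℝ :=
  deriv (fun s => f x (Function.update y k s)) (y k)

/-- Iterated partial derivative `∂ₓ^k f` of a scalar function of `(x, y)`. -/
def dxIter {m : ℕ} : ℕ → (ℝ → (Fin m → ℝ) → ℝ) → ℝ → (Fin m → ℝ) → ℝ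
  | 0, f => f
  | (k+1), f => dxF (dxIter k f)

/-- The standing hypotheses on the data of a gas giant in `g`-boundary normal coordinates:
`n ≥ 2`, `ε ∈ (0,1]`, `U ⊆ ℝ^{n-1}` open, and `A : [0,ε) × U → ℝ^{(n-1)×(n-1)}` symmetric
positive definite (with uniform ellipticity constants `0 < lam ≤ Lam`), extending to a `C^∞`
map on an open neighborhood of `[0,ε) × U`, with all first-order partial derivatives of all
entries bounded by `Lam`.  (`A` plays the role of the inverse boundary metric `h^{ij}` of the
gas giant metric `g = dx² + x⁻² h(x,y,dy)`.) -/
structure GasGiantData (n : ℕ) (ε : ℝ) (U : Set (Fin (n-1) → ℝ))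
    (A : ℝ → (Fin (n-1) → ℝ) → Matrix (Fin (n-1)) (Fin (n-1)) ℝ)
    (lam Lam : ℝ) : Prop where
  hn : 2 ≤ n
  hε : ε ∈ Set.Ioc (0:ℝ) 1
  hU : IsOpen U
  hlam : 0 < lam
  hlamLam : lam ≤ Lam
  hsymm : ∀ x ∈ Set.Ico (0:ℝ) ε, ∀ y ∈ U, (A x y).IsSymm
  hsmooth : ∃ W : Set (ℝ × (Fin (n-1) → ℝ)), IsOpen W ∧ Set.Ico (0:ℝ) ε ×ˢ U ⊆ W ∧
    ∀ i j, ContDiffOn ℝ (⊤ : ℕ∞) (fun p : ℝ × (Fin (n-1) → ℝ) => A p.1 p.2 i j) W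
  hposdef : ∀ x ∈ Set.Ico (0:ℝ) ε, ∀ y ∈ U, ∀ v : Fin (n-1) → ℝ,
    lam * (∑ i, v i ^ 2) ≤ quadForm (A x y) v v ∧ quadForm (A x y) v v ≤ Lam * (∑ i, v i ^ 2)
  hderivBound : ∀ x ∈ Set.Ico (0:ℝ) ε, ∀ y ∈ U,
    (∀ i j, |dxA A x y i j| ≤ Lam) ∧ (∀ k i j, |dyA A k x y i j| ≤ Lam)

/-- A Hamiltonian trajectory on the interval `I` for the gas giant Hamiltonian
`H(x,y,ξ,η) = ½ ξ² + ½ x² ⟨A(x,y)η, η⟩`: a `C¹` curve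
`t ↦ (x(t), y(t), ξ(t), η(t)) ∈ [0,ε) × U × ℝ × ℝ^{n-1}` satisfying Hamilton's equations. -/
structure IsHamTraj (n : ℕ) (ε : ℝ) (U : Set (Fin (n-1) → ℝ))
    (A : ℝ → (Fin (n-1) → ℝ) → Matrix (Fin (n-1)) (Fin (n-1)) ℝ) (I : Set ℝ)
    (x : ℝ → ℝ) (y : ℝ → Fin (n-1) → ℝ) (ξ : ℝ → ℝ) (η : ℝ → Fin (n-1) → ℝ) : Prop where
  mem : ∀ t ∈ I, x t ∈ Set.Ico (0:ℝ) ε ∧ y t ∈ U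
  hx : ∀ t ∈ I, HasDerivAt x (ξ t) t
  hy : ∀ t ∈ I, ∀ i, HasDerivAt (fun t' => y t' i)
    ((x t)^2 * ∑ j, A (x t) (y t) i j * η t j) t
  hxi : ∀ t ∈ I, HasDerivAt ξ
    (-(x t * quadForm (A (x t) (y t)) (η t) (η t))
      - (1/2) * (x t)^2 * quadForm (dxA A (x t) (y t)) (η t) (η t)) t
  heta : ∀ t ∈ I, ∀ i, HasDerivAt (fun t' => η t' i)
    (-(1/2) * (x t)^2 * quadForm (dyA A i (x t) (y t)) (η t) (η t)) t

/-- A short-geodesic trajectory with data `(y₀, η₀, s)`: a Hamiltonian trajectory on `[0,T]`,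
`T > 0`, with initial value `(0, y₀, s, η₀)`, with `x(T) = 0` and `x(t) > 0` on `(0,T)`. -/
def IsShortGeo (n : ℕ) (ε : ℝ) (U : Set (Fin (n-1) → ℝ))
    (A : ℝ → (Fin (n-1) → ℝ) → Matrix (Fin (n-1)) (Fin (n-1)) ℝ)
    (y₀ η₀ : Fin (n-1) → ℝ) (s T : ℝ)
    (x : ℝ → ℝ) (y : ℝ → Fin (n-1) → ℝ) (ξ : ℝ → ℝ) (η : ℝ → Fin (n-1) → ℝ) : Prop :=
  0 < T ∧ IsHamTraj n ε U A (Set.Icc 0 T) x y ξ η ∧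
    x 0 = 0 ∧ y 0 = y₀ ∧ ξ 0 = s ∧ η 0 = η₀ ∧ x T = 0 ∧ ∀ t ∈ Set.Ioo 0 T, 0 < x t


/-- Points whose horizontal segment to the hyperplane `x = 0` stays in `W`. -/
def horizontalCore {m : ℕ} (W : Set (ℝ × (Fin m → ℝ))) : Set (ℝ × (Fin m → ℝ)) :=
  {p | ∀ r ∈ Icc (0:ℝ) 1, (r * p.1, p.2) ∈ W}

lemma horizontalCore_exists_nhds {m : ℕ} {W : Set (ℝ × (Fin m → ℝ))} (hW : IsOpen W)
    {p : ℝ × (Fin m → ℝ)} (hp : p ∈ horizontalCore W) :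
    ∃ s : Set (ℝ × (Fin m → ℝ)), ∃ v : Set ℝ, IsOpen s ∧ IsOpen v ∧ p ∈ s ∧ Icc (0:ℝ) 1 ⊆ v ∧
      ∀ p' ∈ s, ∀ r ∈ v, (r * p'.1, p'.2) ∈ W := by
  have hΩ : IsOpen ((fun z : (ℝ × (Fin m → ℝ)) × ℝ => (z.2 * z.1.1, z.1.2)) ⁻¹' W) :=
    hW.preimage (by fun_prop)
  obtain ⟨s, v, hs, hv, hps, hIv, hsv⟩ := generalized_tube_lemma (isCompact_singleton (x := p))
    (isCompact_Icc (a := (0:ℝ)) (b := 1)) hΩ (by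
      rintro ⟨a, r⟩ ⟨ha, hr⟩
      obtain rfl : a = p := ha
      exact hp r hr)
  exact ⟨s, v, hs, hv, hps rfl, hIv, fun p' hp' r hr => hsv (Set.mk_mem_prod hp' hr)⟩

lemma isOpen_horizontalCore {m : ℕ} {W : Set (ℝ × (Fin m → ℝ))} (hW : IsOpen W) :
    IsOpen (horizontalCore W) := by
  rw [isOpen_iff_mem_nhds]
  intro p hp
  obtain ⟨s, v, hs, -, hps, hIv, hsv⟩ := horizontalCore_exists_nhds hW hp
  exact Filter.mem_of_superset (hs.mem_nhds hps) fun p' hp' r hr => hsv p' hp' r (hIv hr)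

/-- Integration over `[0,1]` of a function depending smoothly on a parameter. -/
lemma contDiffOn_integral_unitInterval {P : Type*} [NormedAddCommGroup P] [NormedSpace ℝ P]
    {F : P → ℝ → ℝ} {s : Set P} {v : Set ℝ} (hs : IsOpen s) (hv : IsOpen v)
    (hIv : Icc (0:ℝ) 1 ⊆ v)
    (hF : ContDiffOn ℝ (⊤ : ℕ∞) (fun z : P × ℝ => F z.1 z.2) (s ×ˢ v)) :
    ContDiffOn ℝ (⊤ : ℕ∞) (fun p => ∫ r in (0:ℝ)..1, F p r) s := by
  obtain ⟨δ, hδ, hδv⟩ := isCompact_Icc.exists_cthickening_subset_open hv hIv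
  have hIcc : Icc (0:ℝ) 1 = Metric.closedBall (1/2) (1/2) := by
    rw [Real.closedBall_eq_Icc]; norm_num
  let χ : ContDiffBump (1/2 : ℝ) := ⟨1/2, 1/2 + δ, by norm_num, by linarith⟩
  have hχv : tsupport χ ⊆ v := by
    rw [χ.tsupport_eq]
    refine subset_trans ?_ hδv
    intro r hr
    rw [hIcc, cthickening_closedBall hδ.le (by norm_num)]
    rw [add_comm]
    exact hr
  have hone : ∀ r ∈ Icc (0:ℝ) 1, χ r = 1 := fun r hr =>
    χ.one_of_mem_closedBall (by rw [hIcc] at hr; exact hr)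
  let g : P → ℝ → ℝ := fun p r => χ r * F p r
  have hg : ContDiffOn ℝ (⊤ : ℕ∞) (Function.uncurry g) (s ×ˢ univ) := by
    intro z hz
    apply ContDiffAt.contDiffWithinAt
    by_cases hzv : z.2 ∈ v
    · have h1 : ContDiffAt ℝ (⊤ : ℕ∞) (fun z : P × ℝ => F z.1 z.2) z :=
        hF.contDiffAt ((hs.prod hv).mem_nhds ⟨hz.1, hzv⟩)
      have h2 : ContDiffAt ℝ (⊤ : ℕ∞) (fun z : P × ℝ => χ z.2) z :=
        (χ.contDiff.comp contDiff_snd).contDiffAt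
      exact h2.mul h1
    · have hz0 : ∀ᶠ z' in nhds z, Function.uncurry g z' = 0 := by
        have ho : IsOpen ((fun z : P × ℝ => z.2) ⁻¹' (tsupport χ)ᶜ) :=
          (isClosed_tsupport _).isOpen_compl.preimage continuous_snd
        filter_upwards [ho.mem_nhds (show z ∈ _ from fun h => hzv (hχv h))] with z' hz'
        have : χ z'.2 = 0 := image_eq_zero_of_notMem_tsupport hz'
        simp [Function.uncurry, g, this]
      exact (contDiffAt_const (c := (0:ℝ))).congr_of_eventuallyEq hz0
  have key := MeasureTheory.contDiffOn_convolution_right_with_param_comp (μ := MeasureTheory.volume)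
    (ContinuousLinearMap.mul ℝ ℝ) (v := fun _ : P => (1:ℝ)) (s := s) (n := ⊤) contDiffOn_const
    (f := (Ioc (0:ℝ) 1).indicator fun _ => (1:ℝ)) (g := g) (k := tsupport χ) hs
    χ.hasCompactSupport
    (fun p x _ hx => by
      have : χ x = 0 := image_eq_zero_of_notMem_tsupport hx
      simp [g, this])
    ((MeasureTheory.integrable_indicator_iff measurableSet_Ioc).2
      (MeasureTheory.integrableOn_const (by simp))).locallyIntegrable hg
  refine key.congr fun p _ => ?_
  have h1 : ∀ t, ((ContinuousLinearMap.mul ℝ ℝ) ((Ioc (0:ℝ) 1).indicator (fun _ => (1:ℝ)) t))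
      (g p (1 - t)) = (Ioc (0:ℝ) 1).indicator (fun t => g p (1 - t)) t := by
    intro t
    by_cases ht : t ∈ Ioc (0:ℝ) 1 <;> simp [ht]
  rw [MeasureTheory.convolution]
  simp_rw [h1]
  rw [MeasureTheory.integral_indicator measurableSet_Ioc,
    ← intervalIntegral.integral_of_le zero_le_one,
    intervalIntegral.integral_comp_sub_left (fun t => g p t) 1]
  simp only [sub_self, sub_zero]
  refine intervalIntegral.integral_congr fun r hr => ?_
  rw [uIcc_of_le zero_le_one] at hr
  simp [g, hone r hr]

/-- The primitive in the first variable, normalized to vanish on `x = 0`, is smooth. -/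
lemma contDiffOn_horizontal_primitive {m : ℕ} {W : Set (ℝ × (Fin m → ℝ))} (hW : IsOpen W)
    {f : ℝ → (Fin m → ℝ) → ℝ} (hf : ContDiffOn ℝ (⊤ : ℕ∞) (fun p : ℝ × (Fin m → ℝ) => f p.1 p.2) W) :
    ContDiffOn ℝ (⊤ : ℕ∞) (fun p : ℝ × (Fin m → ℝ) => ∫ r in (0:ℝ)..p.1, f r p.2)
      (horizontalCore W) := by
  intro p hp
  apply ContDiffAt.contDiffWithinAt
  obtain ⟨s, v, hs, hv, hps, hIv, hsv⟩ := horizontalCore_exists_nhds hW hp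
  have h := contDiffOn_integral_unitInterval (F := fun p r => f (r * p.1) p.2) hs hv hIv
    (hf.comp (f := fun z : (ℝ × (Fin m → ℝ)) × ℝ => (z.2 * z.1.1, z.1.2))
      (by fun_prop) fun z hz => hsv z.1 hz.1 z.2 hz.2)
  have h2 := (contDiffAt_fst (𝕜 := ℝ) (n := (⊤ : ℕ∞)) (p := p)).mul
    (h.contDiffAt (hs.mem_nhds hps))
  refine h2.congr_of_eventuallyEq (Filter.Eventually.of_forall fun p' => ?_)
  have := intervalIntegral.mul_integral_comp_mul_right (a := 0) (b := 1)
    (f := fun r => f r p'.2) p'.1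
  simp only [zero_mul, one_mul] at this
  exact this.symm

lemma hasDerivAt_horizontal_primitive {m : ℕ} {W : Set (ℝ × (Fin m → ℝ))} (hW : IsOpen W)
    {f : ℝ → (Fin m → ℝ) → ℝ} (hf : ContinuousOn (fun p : ℝ × (Fin m → ℝ) => f p.1 p.2) W)
    {p : ℝ × (Fin m → ℝ)} (hp : p ∈ horizontalCore W) :
    HasDerivAt (fun x => ∫ r in (0:ℝ)..x, f r p.2) (f p.1 p.2) p.1 := by
  have hc : ContinuousOn (fun r => f r p.2) ((fun r => (r, p.2)) ⁻¹' W) :=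
    hf.comp (f := fun r => (r, p.2)) (by fun_prop) fun r hr => hr
  have ho : IsOpen ((fun r => (r, p.2)) ⁻¹' W) := hW.preimage (by fun_prop)
  have hpW : p.1 ∈ (fun r => (r, p.2)) ⁻¹' W := by
    simpa using hp 1 (by simp)
  have hsub : uIcc 0 p.1 ⊆ (fun r => (r, p.2)) ⁻¹' W := by
    intro r hr
    rw [← segment_eq_uIcc] at hr
    obtain ⟨a, b, ha, hb, hab, rfl⟩ := hr
    simpa using hp b ⟨hb, by linarith⟩
  exact intervalIntegral.integral_hasDerivAt_right (hc.mono hsub).intervalIntegrable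
    (hc.stronglyMeasurableAtFilter ho _ hpW) (hc.continuousAt (ho.mem_nhds hpW))

lemma hasDerivAt_fst_of_mem {m : ℕ} {W : Set (ℝ × (Fin m → ℝ))} (hW : IsOpen W)
    {g : ℝ → (Fin m → ℝ) → ℝ} (hg : ContDiffOn ℝ (⊤ : ℕ∞) (fun p : ℝ × (Fin m → ℝ) => g p.1 p.2) W)
    {x : ℝ} {y : Fin m → ℝ} (hp : (x, y) ∈ W) :
    HasDerivAt (fun x' => g x' y)
      (fderiv ℝ (fun p : ℝ × (Fin m → ℝ) => g p.1 p.2) (x, y) (1, 0)) x := by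
  have h := ((hg.contDiffAt (hW.mem_nhds hp)).differentiableAt (by simp)).hasFDerivAt
  exact h.comp_hasDerivAt (f := fun x' => (x', y)) x
    ((hasDerivAt_id x).prodMk (hasDerivAt_const x y))

lemma hasDerivAt_update_of_mem {m : ℕ} {W : Set (ℝ × (Fin m → ℝ))} (hW : IsOpen W)
    {g : ℝ → (Fin m → ℝ) → ℝ} (hg : ContDiffOn ℝ (⊤ : ℕ∞) (fun p : ℝ × (Fin m → ℝ) => g p.1 p.2) W)
    {x : ℝ} {y : Fin m → ℝ} (hp : (x, y) ∈ W) (k : Fin m) :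
    HasDerivAt (fun s => g x (Function.update y k s))
      (fderiv ℝ (fun p : ℝ × (Fin m → ℝ) => g p.1 p.2) (x, y) (0, Pi.single k 1)) (y k) := by
  have h := ((hg.contDiffAt (hW.mem_nhds hp)).differentiableAt (by simp)).hasFDerivAt
  have h' : HasFDerivAt (fun p : ℝ × (Fin m → ℝ) => g p.1 p.2)
      (fderiv ℝ (fun p : ℝ × (Fin m → ℝ) => g p.1 p.2) (x, y))
      (x, Function.update y k (y k)) := by simpa using h
  exact h'.comp_hasDerivAt (f := fun s => (x, Function.update y k s)) (y k)
    ((hasDerivAt_const (y k) x).prodMk (hasDerivAt_update y k (y k)))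

lemma contDiffOn_fderiv_apply {m : ℕ} {W : Set (ℝ × (Fin m → ℝ))} (hW : IsOpen W)
    {G : ℝ × (Fin m → ℝ) → ℝ} (hG : ContDiffOn ℝ (⊤ : ℕ∞) G W) (v : ℝ × (Fin m → ℝ)) :
    ContDiffOn ℝ (⊤ : ℕ∞) (fun p => fderiv ℝ G p v) W :=
  (hG.fderiv_of_isOpen hW (m := (⊤ : ℕ∞)) (by simp)).clm_apply contDiffOn_const

lemma contDiffOn_dxF {m : ℕ} {W : Set (ℝ × (Fin m → ℝ))} (hW : IsOpen W)
    {g : ℝ → (Fin m → ℝ) → ℝ}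
    (hg : ContDiffOn ℝ (⊤ : ℕ∞) (fun p : ℝ × (Fin m → ℝ) => g p.1 p.2) W) :
    ContDiffOn ℝ (⊤ : ℕ∞) (fun p : ℝ × (Fin m → ℝ) => dxF g p.1 p.2) W :=
  (contDiffOn_fderiv_apply hW hg (1, 0)).congr fun _ hp => (hasDerivAt_fst_of_mem hW hg hp).deriv

lemma contDiffOn_dyF {m : ℕ} {W : Set (ℝ × (Fin m → ℝ))} (hW : IsOpen W)
    {g : ℝ → (Fin m → ℝ) → ℝ}
    (hg : ContDiffOn ℝ (⊤ : ℕ∞) (fun p : ℝ × (Fin m → ℝ) => g p.1 p.2) W) (k : Fin m) :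
    ContDiffOn ℝ (⊤ : ℕ∞) (fun p : ℝ × (Fin m → ℝ) => dyF g k p.1 p.2) W :=
  (contDiffOn_fderiv_apply hW hg (0, Pi.single k 1)).congr fun _ hp =>
    (hasDerivAt_update_of_mem hW hg hp k).deriv

lemma contDiffOn_dxIter {m : ℕ} {W : Set (ℝ × (Fin m → ℝ))} (hW : IsOpen W)
    {g : ℝ → (Fin m → ℝ) → ℝ}
    (hg : ContDiffOn ℝ (⊤ : ℕ∞) (fun p : ℝ × (Fin m → ℝ) => g p.1 p.2) W) (k : ℕ) :
    ContDiffOn ℝ (⊤ : ℕ∞) (fun p : ℝ × (Fin m → ℝ) => dxIter k g p.1 p.2) W := by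
  induction k with
  | zero => exact hg
  | succ k ih => exact contDiffOn_dxF hW ih

lemma hasDerivAt_dxIter {m : ℕ} {W : Set (ℝ × (Fin m → ℝ))} (hW : IsOpen W)
    {g : ℝ → (Fin m → ℝ) → ℝ}
    (hg : ContDiffOn ℝ (⊤ : ℕ∞) (fun p : ℝ × (Fin m → ℝ) => g p.1 p.2) W) (k : ℕ)
    {x : ℝ} {y : Fin m → ℝ} (hp : (x, y) ∈ W) :
    HasDerivAt (fun x' => dxIter k g x' y) (dxIter (k + 1) g x y) x :=
  (hasDerivAt_fst_of_mem hW (contDiffOn_dxIter hW hg k) hp).differentiableAt.hasDerivAt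

lemma dxIter_eq_zero_of_eqOn {m : ℕ} {W : Set (ℝ × (Fin m → ℝ))} (hW : IsOpen W)
    {g : ℝ → (Fin m → ℝ) → ℝ} (hg : ∀ p ∈ W, g p.1 p.2 = 0) (k : ℕ) :
    ∀ p ∈ W, dxIter k g p.1 p.2 = 0 := by
  induction k with
  | zero => exact hg
  | succ k ih =>
    intro p hp
    have ho : IsOpen ((fun r => (r, p.2)) ⁻¹' W) := hW.preimage (by fun_prop)
    have : (fun x' => dxIter k g x' p.2) =ᶠ[nhds p.1] fun _ => 0 := by
      filter_upwards [ho.mem_nhds (show p.1 ∈ _ from hp)] with r hr using ih _ hr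
    change deriv (fun x' => dxIter k g x' p.2) p.1 = 0
    rw [this.deriv_eq, deriv_const]

lemma hasDerivAt_along_curve {m : ℕ} {W : Set (ℝ × (Fin m → ℝ))} (hW : IsOpen W)
    {g : ℝ → (Fin m → ℝ) → ℝ} (hg : ContDiffOn ℝ (⊤ : ℕ∞) (fun p : ℝ × (Fin m → ℝ) => g p.1 p.2) W)
    {x : ℝ → ℝ} {y : ℝ → Fin m → ℝ} {t x' : ℝ} {y' : Fin m → ℝ} (hp : (x t, y t) ∈ W)
    (hx : HasDerivAt x x' t) (hy : ∀ i, HasDerivAt (fun t => y t i) (y' i) t) :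
    HasDerivAt (fun t => g (x t) (y t))
      (dxF g (x t) (y t) * x' + ∑ i, dyF g i (x t) (y t) * y' i) t := by
  have h := ((hg.contDiffAt (hW.mem_nhds hp)).differentiableAt (by simp)).hasFDerivAt
  have h1 := h.comp_hasDerivAt (f := fun t => (x t, y t)) t (hx.prodMk (hasDerivAt_pi.2 hy))
  refine h1.congr_deriv ?_
  have e1 : dxF g (x t) (y t) = _ := (hasDerivAt_fst_of_mem hW hg hp).deriv
  have e2 : ∀ i, dyF g i (x t) (y t) = _ := fun i => (hasDerivAt_update_of_mem hW hg hp i).deriv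
  rw [e1]
  simp_rw [e2]
  have e3 : ((x', y') : ℝ × (Fin m → ℝ))
      = x' • ((1 : ℝ), (0 : Fin m → ℝ)) + ∑ i, y' i • ((0 : ℝ), (Pi.single i 1 : Fin m → ℝ)) := by
    ext j
    · simp [Prod.fst_sum]
    · simp [Prod.snd_sum, Pi.single_apply]
  rw [e3, map_add, map_sum, map_smul]
  simp_rw [map_smul, smul_eq_mul]
  congr 1
  · ring
  · exact Finset.sum_congr rfl fun i _ => mul_comm _ _

/-- Taylor estimate: if the first `k` terms of a chain of successive derivatives vanish at `0`
and the `k`-th one is within `e` of `a` on `[0, X]`, then the bottom function is within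
`e x ^ k / k!` of `a x ^ k / k!`. -/
lemma abs_sub_monomial_le {X a e : ℝ} (k : ℕ) (φ : ℕ → ℝ → ℝ)
    (hφ : ∀ j, ∀ x ∈ Icc 0 X, HasDerivAt (φ j) (φ (j + 1) x) x)
    (h0 : ∀ j < k, φ j 0 = 0) (hk : ∀ x ∈ Icc 0 X, |φ k x - a| ≤ e) :
    ∀ x ∈ Icc 0 X, |φ 0 x - a * (x ^ k / k.factorial)| ≤ e * (x ^ k / k.factorial) := by
  induction k generalizing φ with
  | zero => simpa using hk
  | succ k ih =>
    have ih' := ih (fun j => φ (j + 1)) (fun j => hφ (j + 1)) (fun j hj => h0 (j + 1) (by omega)) hk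
    have hmono : ∀ x : ℝ, HasDerivAt (fun x : ℝ => x ^ (k + 1) / ((k + 1).factorial : ℝ))
        (x ^ k / k.factorial) x := by
      intro x
      refine ((hasDerivAt_pow (k + 1) x).div_const _).congr_deriv ?_
      rw [Nat.factorial_succ]
      have : (k.factorial : ℝ) ≠ 0 := by positivity
      push_cast
      field_simp
    have hd : ∀ x ∈ Icc 0 X, HasDerivAt (fun x => φ 0 x - a * (x ^ (k + 1) / (k + 1).factorial))
        (φ 1 x - a * (x ^ k / k.factorial)) x := fun x hx =>
      (hφ 0 x hx).sub ((hmono x).const_mul a)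
    intro x hx
    exact image_norm_le_of_norm_deriv_right_le_deriv_boundary
      (fun x hx => (hd x hx).continuousAt.continuousWithinAt)
      (fun x hx => (hd x (Ico_subset_Icc_self hx)).hasDerivWithinAt)
      (by simp [h0 0 (by omega)]) (fun x => (hmono x).const_mul e)
      (fun x hx => ih' x (Ico_subset_Icc_self hx)) hx

/-- A nearly harmonic oscillator started at `0` with speed `s`, with frequency between
`1/2` and `2`. -/
lemma oscillator_bounds {x ξ ω : ℝ → ℝ} {τ s : ℝ} (hs : 0 ≤ s)
    (hx : ∀ t ∈ Icc 0 τ, HasDerivAt x (ξ t) t)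
    (hξ : ∀ t ∈ Icc 0 τ, HasDerivAt ξ (-(x t * ω t)) t)
    (hω : ∀ t ∈ Icc 0 τ, ω t ∈ Icc (1/2 : ℝ) 2) (hpos : ∀ t ∈ Icc 0 τ, 0 ≤ x t)
    (hx0 : x 0 = 0) (hξ0 : ξ 0 = s) :
    ∀ t ∈ Icc 0 τ, x t ≤ 2 * s ∧ |ξ t| ≤ 2 * s := by
  have hanti : AntitoneOn ξ (Icc 0 τ) := by
    refine antitoneOn_of_deriv_nonpos (convex_Icc 0 τ)
      (fun t ht => (hξ t ht).continuousAt.continuousWithinAt)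
      (fun t ht => (hξ t (interior_subset ht)).differentiableAt.differentiableWithinAt) ?_
    intro t ht
    have ht' := interior_subset ht
    rw [(hξ t ht').deriv]
    nlinarith [hpos t ht', (hω t ht').1]
  have henergy : ∀ c : ℝ, ∀ a b : ℝ, 0 ≤ a → a ≤ b → b ≤ τ →
      (∀ t ∈ Icc a b, ξ t * (c - ω t) ≤ 0) →
      ξ b ^ 2 + c * x b ^ 2 ≤ ξ a ^ 2 + c * x a ^ 2 := by
    intro c a b ha hab hb h
    have hsub : Icc a b ⊆ Icc 0 τ := Icc_subset_Icc ha hb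
    have hd : ∀ t ∈ Icc a b, HasDerivAt (fun t => ξ t ^ 2 + c * x t ^ 2)
        (2 * x t * (ξ t * (c - ω t))) t := fun t ht =>
      (((hξ t (hsub ht)).pow 2).add (((hx t (hsub ht)).pow 2).const_mul c)).congr_deriv
        (by simp; ring)
    refine antitoneOn_of_deriv_nonpos (f := fun t => ξ t ^ 2 + c * x t ^ 2) (convex_Icc a b)
      (fun t ht => (hd t ht).continuousAt.continuousWithinAt)
      (fun t ht => (hd t (interior_subset ht)).differentiableAt.differentiableWithinAt) ?_
      (left_mem_Icc.2 hab) (right_mem_Icc.2 hab) hab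
    intro t ht
    have ht' := interior_subset ht
    rw [(hd t ht').deriv]
    exact mul_nonpos_of_nonneg_of_nonpos (by linarith [hpos t (hsub ht')]) (h t ht')
  have hup : ∀ t ∈ Icc 0 τ, 0 ≤ ξ t → ξ t ^ 2 + 1/2 * x t ^ 2 ≤ s ^ 2 := by
    intro t ht h
    have := henergy (1/2) 0 t le_rfl ht.1 ht.2 fun r hr => by
      have hr' : r ∈ Icc 0 τ := ⟨hr.1, hr.2.trans ht.2⟩
      have h1 : ξ t ≤ ξ r := hanti hr' ht hr.2
      exact mul_nonpos_of_nonneg_of_nonpos (h.trans h1) (by linarith [(hω r hr').1])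
    rw [hx0, hξ0] at this
    linarith
  intro t ht
  rcases le_or_gt 0 (ξ t) with h | h
  · have := hup t ht h
    exact ⟨by nlinarith [hpos t ht], abs_le_of_sq_le_sq (by nlinarith) (by linarith)⟩
  · have h0mem : (0:ℝ) ∈ Icc 0 τ := ⟨le_rfl, ht.1.trans ht.2⟩
    obtain ⟨a, ha, hξa⟩ := intermediate_value_Icc' ht.1 (f := ξ)
      (fun r hr => (hξ r ⟨hr.1, hr.2.trans ht.2⟩).continuousAt.continuousWithinAt)
      (show (0:ℝ) ∈ Icc (ξ t) (ξ 0) from ⟨h.le, by rw [hξ0]; exact hs⟩)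
    have ha' : a ∈ Icc 0 τ := ⟨ha.1, ha.2.trans ht.2⟩
    have h1 := hup a ha' hξa.ge
    have h2 := henergy 2 a t ha.1 ha.2 ht.2 fun r hr => by
      have hr' : r ∈ Icc 0 τ := ⟨ha.1.trans hr.1, hr.2.trans ht.2⟩
      have h3 : ξ r ≤ ξ a := hanti ha' hr' hr.1
      rw [hξa] at h3
      exact mul_nonpos_of_nonpos_of_nonneg h3 (by linarith [(hω r hr').2])
    rw [hξa] at h1 h2
    exact ⟨by nlinarith [hpos t ht, sq_nonneg (ξ t)],
      abs_le_of_sq_le_sq (by nlinarith [sq_nonneg (x t)]) (by linarith)⟩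

/-- A slowly launched trajectory of a system that looks like a harmonic oscillator in `(x, ξ)`
near `(0, p₀)`, with the remaining variables moving at speed at most `x`, stays near `p₀`. -/
lemma trajectory_stays_near {E : Type*} [NormedAddCommGroup E] [NormedSpace ℝ E]
    {x ξ ω : ℝ → ℝ} {p p' : ℝ → E} {p₀ : E} {T s δ : ℝ} (hs : 0 < s) (hsδ : 6 * s < δ)
    (hx : ∀ t ∈ Icc 0 T, HasDerivAt x (ξ t) t)
    (hξ : ∀ t ∈ Icc 0 T, HasDerivAt ξ (-(x t * ω t)) t)
    (hp : ∀ t ∈ Icc 0 T, HasDerivAt p (p' t) t)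
    (hω : ∀ t ∈ Icc 0 T, x t ≤ δ → ‖p t - p₀‖ ≤ δ → ω t ∈ Icc (1/2 : ℝ) 2 ∧ ‖p' t‖ ≤ x t)
    (hpos : ∀ t ∈ Icc 0 T, 0 ≤ x t) (hx0 : x 0 = 0) (hξ0 : ξ 0 = s) (hp0 : p 0 = p₀) :
    ∀ t ∈ Icc 0 T, x t ≤ δ ∧ ‖p t - p₀‖ ≤ δ := by
  have hδ : 0 < δ := by linarith
  have hgc : ContinuousOn (fun t => max (x t) ‖p t - p₀‖) (Icc 0 T) := by
    refine ContinuousOn.sup (fun t ht => (hx t ht).continuousAt.continuousWithinAt) ?_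
    exact (ContinuousOn.sub (fun t ht => (hp t ht).continuousAt.continuousWithinAt)
      continuousOn_const).norm
  have hg0 : max (x 0) ‖p 0 - p₀‖ = 0 := by simp [hx0, hp0]
  have hest : ∀ τ, τ ≤ T → (∀ t ∈ Icc 0 τ, max (x t) ‖p t - p₀‖ ≤ δ) →
      ∀ t ∈ Icc 0 τ, max (x t) ‖p t - p₀‖ < δ := by
    intro τ hτ hb t ht
    have hsub : ∀ r ∈ Icc 0 τ, r ∈ Icc 0 T := fun r hr => ⟨hr.1, hr.2.trans hτ⟩
    have hω' : ∀ r ∈ Icc 0 τ, ω r ∈ Icc (1/2 : ℝ) 2 ∧ ‖p' r‖ ≤ x r := fun r hr =>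
      hω r (hsub r hr) ((le_max_left _ _).trans (hb r hr)) ((le_max_right _ _).trans (hb r hr))
    obtain ⟨h1, h2⟩ := oscillator_bounds hs.le (fun r hr => hx r (hsub r hr))
      (fun r hr => hξ r (hsub r hr)) (fun r hr => (hω' r hr).1) (fun r hr => hpos r (hsub r hr))
      hx0 hξ0 t ht
    have hB : ∀ r ∈ Icc 0 τ, HasDerivAt (fun r => 2 * (s - ξ r)) (2 * (x r * ω r)) r := fun r hr =>
      (((hξ r (hsub r hr)).const_sub s).const_mul 2).congr_deriv (by ring)
    have h3 : ‖p t - p₀‖ ≤ 2 * (s - ξ t) :=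
      image_norm_le_of_norm_deriv_right_le_deriv_boundary' (f := fun r => p r - p₀) (f' := p')
        (B := fun r => 2 * (s - ξ r)) (B' := fun r => 2 * (x r * ω r))
        (fun r hr => ((hp r (hsub r hr)).sub_const p₀).continuousAt.continuousWithinAt)
        (fun r hr => ((hp r (hsub r ⟨hr.1, hr.2.le⟩)).sub_const p₀).hasDerivWithinAt)
        (by simp [hp0, hξ0])
        (fun r hr => (hB r hr).continuousAt.continuousWithinAt)
        (fun r hr => (hB r ⟨hr.1, hr.2.le⟩).hasDerivWithinAt)
        (fun r hr => by
          have hr' : r ∈ Icc 0 τ := ⟨hr.1, hr.2.le⟩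
          nlinarith [(hω' r hr').2, (hω' r hr').1.1, hpos r (hsub r hr')]) ht
    have := neg_abs_le (ξ t)
    exact max_lt (by linarith) (by linarith)
  suffices h : ∀ t ∈ Icc 0 T, max (x t) ‖p t - p₀‖ ≤ δ from fun t ht => max_le_iff.1 (h t ht)
  by_contra! hcon
  obtain ⟨t₁, ht₁, hbad⟩ := hcon
  have hc1 : ContinuousOn (fun t => max (x t) ‖p t - p₀‖) (Icc 0 t₁) :=
    hgc.mono (Icc_subset_Icc_right ht₁.2)
  have hScl : IsCompact (Icc 0 t₁ ∩ (fun t => max (x t) ‖p t - p₀‖) ⁻¹' {δ}) :=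
    isCompact_Icc.of_isClosed_subset (hc1.preimage_isClosed_of_isClosed isClosed_Icc
      isClosed_singleton) inter_subset_left
  have hSne : (Icc 0 t₁ ∩ (fun t => max (x t) ‖p t - p₀‖) ⁻¹' {δ}).Nonempty := by
    obtain ⟨a, ha, hga⟩ := intermediate_value_Icc ht₁.1 hc1
      (show δ ∈ Icc _ _ from ⟨by simpa [hg0] using hδ.le, hbad.le⟩)
    exact ⟨a, ha, hga⟩
  obtain ⟨τ, ⟨hτ, hgτ⟩, hleast⟩ := hScl.exists_isLeast hSne
  have hτT : τ ≤ T := hτ.2.trans ht₁.2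
  refine (hest τ hτT ?_ τ ⟨hτ.1, le_rfl⟩).ne hgτ
  intro t ht
  by_contra! hlt
  obtain ⟨a, ha, hga⟩ := intermediate_value_Icc ht.1
    (hgc.mono (Icc_subset_Icc_right (ht.2.trans hτT)))
    (show δ ∈ Icc _ _ from ⟨by simpa [hg0] using hδ.le, hlt.le⟩)
  have hτa : τ ≤ a := hleast ⟨⟨ha.1, ha.2.trans (ht.2.trans hτ.2)⟩, hga⟩
  have : t = τ := le_antisymm ht.2 (hτa.trans ha.2)
  rw [this] at hlt
  exact hlt.ne' hgτ

lemma continuousAt_matrix_apply {m : ℕ} {Z : Type*} [TopologicalSpace Z] {z : Z}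
    {M : Z → Matrix (Fin m) (Fin m) ℝ} {v : Z → Fin m → ℝ}
    (hM : ∀ i j, ContinuousAt (fun z => M z i j) z) (hv : ContinuousAt v z) (i : Fin m) :
    ContinuousAt (fun z => ∑ j, M z i j * v z j) z :=
  tendsto_finsetSum _ fun j _ => (hM i j).mul ((continuous_apply j).continuousAt.comp hv)

lemma continuousAt_quadForm {m : ℕ} {Z : Type*} [TopologicalSpace Z] {z : Z}
    {M : Z → Matrix (Fin m) (Fin m) ℝ} {v : Z → Fin m → ℝ}
    (hM : ∀ i j, ContinuousAt (fun z => M z i j) z) (hv : ContinuousAt v z) :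
    ContinuousAt (fun z => quadForm (M z) (v z) (v z)) z :=
  tendsto_finsetSum _ fun i _ => (continuousAt_matrix_apply hM hv i).mul
    ((continuous_apply i).continuousAt.comp hv)

lemma exists_forall_dotProduct_pos {m : ℕ} {a w : Fin m → ℝ} (h : 0 < ∑ i, a i * w i) :
    ∃ e > 0, ∀ b w' : Fin m → ℝ, (∀ i, |b i - a i| ≤ e) → (∀ i, |w' i - w i| ≤ e) →
      0 < ∑ i, b i * w' i := by
  have hc : Continuous fun z : (Fin m → ℝ) × (Fin m → ℝ) => ∑ i, z.1 i * z.2 i := by fun_prop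
  obtain ⟨d, hd, hball⟩ := Metric.eventually_nhds_iff.1
    (hc.continuousAt.eventually (lt_mem_nhds (a := 0) (b := ∑ i, (a, w).1 i * (a, w).2 i) h))
  refine ⟨d / 2, by linarith, fun b w' hb hw => hball (y := (b, w')) ?_⟩
  have h1 : dist b a ≤ d / 2 := (dist_pi_le_iff (by linarith)).2 hb
  have h2 : dist w' w ≤ d / 2 := (dist_pi_le_iff (by linarith)).2 hw
  rw [Prod.dist_eq]
  exact (max_le h1 h2).trans_lt (by linarith)

lemma exists_unit_covector {m : ℕ} {M : Matrix (Fin m) (Fin m) ℝ} {a : Fin m → ℝ}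
    (ha : 0 < quadForm M a a) :
    ∃ v : Fin m → ℝ, quadForm M v v = 1 ∧ 0 < ∑ i, a i * ∑ j, M i j * v j := by
  have hs : ∀ (c : ℝ) (i : Fin m), ∑ j, M i j * (c * a j) = c * ∑ j, M i j * a j := by
    intro c i
    rw [Finset.mul_sum]
    exact Finset.sum_congr rfl fun j _ => by ring
  set c := (Real.sqrt (quadForm M a a))⁻¹ with hc
  have hcpos : 0 < c := inv_pos.2 (Real.sqrt_pos.2 ha)
  have hc2 : c ^ 2 * quadForm M a a = 1 := by
    rw [hc, inv_pow, Real.sq_sqrt ha.le, inv_mul_cancel₀ ha.ne']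
  refine ⟨fun j => c * a j, ?_, ?_⟩
  · rw [← hc2, quadForm, quadForm, Finset.mul_sum]
    exact Finset.sum_congr rfl fun i _ => by rw [hs]; ring
  · have : ∑ i, a i * ∑ j, M i j * (c * a j) = c * quadForm M a a := by
      rw [quadForm, Finset.mul_sum]
      exact Finset.sum_congr rfl fun i _ => by rw [hs]; ring
    rw [this]
    positivity

/-- If the tangential one-form `Σᵢ Gᵢ dyⁱ` integrates to zero over all short geodesics and
vanishes to order `k` on `x = 0`, then its `k`-th Taylor coefficient vanishes as well. -/
lemma dxIter_eq_zero_of_xray_eq_zero {n : ℕ} {ε : ℝ} {U : Set (Fin (n-1) → ℝ)}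
    {A : ℝ → (Fin (n-1) → ℝ) → Matrix (Fin (n-1)) (Fin (n-1)) ℝ} {lam Lam : ℝ}
    (hGG : GasGiantData n ε U A lam Lam)
    {G : Fin (n-1) → ℝ → (Fin (n-1) → ℝ) → ℝ} {W : Set (ℝ × (Fin (n-1) → ℝ))}
    (hWo : IsOpen W) (hW : Ico (0:ℝ) ε ×ˢ U ⊆ W)
    (hA : ∀ i j, ContDiffOn ℝ (⊤ : ℕ∞) (fun p : ℝ × (Fin (n-1) → ℝ) => A p.1 p.2 i j) W)
    (hG : ∀ i, ContDiffOn ℝ (⊤ : ℕ∞) (fun p : ℝ × (Fin (n-1) → ℝ) => G i p.1 p.2) W)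
    {s₀ : ℝ} (hs₀ : 0 < s₀)
    (hex : ∀ y₀ ∈ U, ∀ η₀ : Fin (n-1) → ℝ, quadForm (A 0 y₀) η₀ η₀ = 1 →
        ∀ s ∈ Set.Ioo (0:ℝ) s₀,
          ∃ (T : ℝ) (x : ℝ → ℝ) (y : ℝ → Fin (n-1) → ℝ) (ξ : ℝ → ℝ)
            (η : ℝ → Fin (n-1) → ℝ), IsShortGeo n ε U A y₀ η₀ s T x y ξ η)
    (hint : ∀ y₀ ∈ U, ∀ η₀ : Fin (n-1) → ℝ, quadForm (A 0 y₀) η₀ η₀ = 1 →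
        ∀ s ∈ Set.Ioo (0:ℝ) s₀,
        ∀ (T : ℝ) (x : ℝ → ℝ) (y : ℝ → Fin (n-1) → ℝ) (ξ : ℝ → ℝ)
          (η : ℝ → Fin (n-1) → ℝ),
          IsShortGeo n ε U A y₀ η₀ s T x y ξ η →
          (∫ t in (0:ℝ)..T,
            ∑ i, G i (x t) (y t) * ((x t)^2 * ∑ j, A (x t) (y t) i j * η t j)) = 0)
    {k : ℕ} (hk : ∀ j < k, ∀ y ∈ U, ∀ i, dxIter j (G i) 0 y = 0)
    {y₀ : Fin (n-1) → ℝ} (hy₀ : y₀ ∈ U) (i : Fin (n-1)) : dxIter k (G i) 0 y₀ = 0 := by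
  by_contra hne
  have hε : 0 < ε := hGG.hε.1
  have h0ε : (0:ℝ) ∈ Ico 0 ε := ⟨le_rfl, hε⟩
  have hp₀ : ((0:ℝ), y₀) ∈ W := hW ⟨h0ε, hy₀⟩
  set a : Fin (n-1) → ℝ := fun i => dxIter k (G i) 0 y₀ with ha
  have hQ : 0 < quadForm (A 0 y₀) a a := by
    refine lt_of_lt_of_le (mul_pos hGG.hlam ?_) (hGG.hposdef 0 h0ε y₀ hy₀ a).1
    exact Finset.sum_pos' (fun _ _ => sq_nonneg _) ⟨i, Finset.mem_univ _, by positivity⟩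
  obtain ⟨η₀, hη₀, hpair⟩ := exists_unit_covector hQ
  obtain ⟨e, he, hepos⟩ := exists_forall_dotProduct_pos hpair
  -- the phase-space neighbourhood of `(0, y₀, η₀)`
  let z₀ : ℝ × (Fin (n-1) → ℝ) × (Fin (n-1) → ℝ) := (0, y₀, η₀)
  have hlift : ∀ g : ℝ → (Fin (n-1) → ℝ) → ℝ,
      ContDiffOn ℝ (⊤ : ℕ∞) (fun p : ℝ × (Fin (n-1) → ℝ) => g p.1 p.2) W →
      ContinuousAt (fun z : ℝ × (Fin (n-1) → ℝ) × (Fin (n-1) → ℝ) => g z.1 z.2.1) z₀ := by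
    intro g hg
    have h1 : ContinuousAt (fun p : ℝ × (Fin (n-1) → ℝ) => g p.1 p.2) (z₀.1, z₀.2.1) :=
      hg.continuousOn.continuousAt (hWo.mem_nhds hp₀)
    exact h1.comp (f := fun z : ℝ × (Fin (n-1) → ℝ) × (Fin (n-1) → ℝ) => (z.1, z.2.1))
      (by fun_prop)
  have hη : ContinuousAt (fun z : ℝ × (Fin (n-1) → ℝ) × (Fin (n-1) → ℝ) => z.2.2) z₀ := by
    fun_prop
  have hAz := fun i j => hlift (fun x y => A x y i j) (hA i j)
  have hrow := fun i => continuousAt_matrix_apply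
    (M := fun z : ℝ × (Fin (n-1) → ℝ) × (Fin (n-1) → ℝ) => A z.1 z.2.1) hAz hη i
  have hqA := continuousAt_quadForm
    (M := fun z : ℝ × (Fin (n-1) → ℝ) × (Fin (n-1) → ℝ) => A z.1 z.2.1) hAz hη
  have hqx := continuousAt_quadForm
    (M := fun z : ℝ × (Fin (n-1) → ℝ) × (Fin (n-1) → ℝ) => dxA A z.1 z.2.1)
    (fun i j => hlift (dxF fun x y => A x y i j) (contDiffOn_dxF hWo (hA i j))) hη
  have hqy := fun l => continuousAt_quadForm
    (M := fun z : ℝ × (Fin (n-1) → ℝ) × (Fin (n-1) → ℝ) => dyA A l z.1 z.2.1)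
    (fun i j => hlift (dyF (fun x y => A x y i j) l) (contDiffOn_dyF hWo (hA i j) l)) hη
  have hfst : ContinuousAt (fun z : ℝ × (Fin (n-1) → ℝ) × (Fin (n-1) → ℝ) => z.1) z₀ := by
    fun_prop
  have hev : ∀ᶠ z in nhds z₀, (z.1, z.2.1) ∈ W ∧
      (∀ i, |dxIter k (G i) z.1 z.2.1 - a i| ≤ e) ∧
      (∀ i, |(∑ j, A z.1 z.2.1 i j * z.2.2 j) - ∑ j, A 0 y₀ i j * η₀ j| ≤ e) ∧
      (quadForm (A z.1 z.2.1) z.2.2 z.2.2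
        + 1/2 * (z.1 * quadForm (dxA A z.1 z.2.1) z.2.2 z.2.2) ∈ Icc (1/2 : ℝ) 2) ∧
      (∀ i, |z.1 * ∑ j, A z.1 z.2.1 i j * z.2.2 j| ≤ 1) ∧
      (∀ i, |z.1 * quadForm (dyA A i z.1 z.2.1) z.2.2 z.2.2| ≤ 1) := by
    refine Filter.Eventually.and ?_ (Filter.Eventually.and ?_ (Filter.Eventually.and ?_
      (Filter.Eventually.and ?_ (Filter.Eventually.and ?_ ?_))))
    · have hc : Continuous fun z : ℝ × (Fin (n-1) → ℝ) × (Fin (n-1) → ℝ) => (z.1, z.2.1) := by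
        fun_prop
      exact (hWo.preimage hc).mem_nhds hp₀
    · refine Filter.eventually_all.2 fun i => ?_
      have := (hlift _ (contDiffOn_dxIter hWo (hG i) k)).eventually (Metric.closedBall_mem_nhds _ he)
      exact this
    · exact Filter.eventually_all.2 fun i => (hrow i).eventually (Metric.closedBall_mem_nhds _ he)
    · refine (hqA.add ((hfst.mul hqx).const_mul (1/2))).eventually (Icc_mem_nhds ?_ ?_)
      · norm_num [z₀, hη₀]
      · norm_num [z₀, hη₀]
    · refine Filter.eventually_all.2 fun i => ((hfst.mul (hrow i)).abs).eventually
        (Iic_mem_nhds ?_)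
      simp [z₀]
    · refine Filter.eventually_all.2 fun i => ((hfst.mul (hqy i)).abs).eventually
        (Iic_mem_nhds ?_)
      simp [z₀]
  obtain ⟨d, hd, hball⟩ := Metric.eventually_nhds_iff.1 hev
  have hnear : ∀ (r : ℝ) (p : (Fin (n-1) → ℝ) × (Fin (n-1) → ℝ)), 0 ≤ r → r ≤ d / 2 →
      ‖p - (y₀, η₀)‖ ≤ d / 2 → dist (r, p) z₀ < d := by
    intro r p h0 h1 h2
    rw [Prod.dist_eq]
    refine max_lt ?_ (by simp only [z₀]; rw [dist_eq_norm]; linarith)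
    simp only [z₀, Real.dist_eq, sub_zero, abs_of_nonneg h0]
    linarith
  obtain ⟨s, hs, hss₀, hsd⟩ : ∃ s : ℝ, 0 < s ∧ s < s₀ ∧ 6 * s < d / 2 :=
    ⟨min (s₀ / 2) (d / 24), by positivity, (min_le_left _ _).trans_lt (by linarith),
      by linarith [min_le_right (s₀ / 2) (d / 24)]⟩
  obtain ⟨T, x, y, ξ, η, hgeo⟩ := hex y₀ hy₀ η₀ hη₀ s ⟨hs, hss₀⟩
  have hzero := hint y₀ hy₀ η₀ hη₀ s ⟨hs, hss₀⟩ T x y ξ η hgeo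
  obtain ⟨hT, htraj, hx0, hy0, hξ0, hη0, -, hxpos⟩ := hgeo
  have hxnn : ∀ t ∈ Icc 0 T, 0 ≤ x t := fun t ht => (htraj.mem t ht).1.1
  have hstay := trajectory_stays_near (p := fun t => (y t, η t)) (p₀ := (y₀, η₀)) (x := x) (ξ := ξ)
    (ω := fun t => quadForm (A (x t) (y t)) (η t) (η t)
        + 1/2 * (x t * quadForm (dxA A (x t) (y t)) (η t) (η t)))
    (p' := fun t => (fun i => (x t)^2 * ∑ j, A (x t) (y t) i j * η t j,
      fun i => -(1/2) * (x t)^2 * quadForm (dyA A i (x t) (y t)) (η t) (η t)))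
    hs hsd htraj.hx (fun t ht => (htraj.hxi t ht).congr_deriv (by ring))
    (fun t ht => (hasDerivAt_pi.2 (htraj.hy t ht)).prodMk (hasDerivAt_pi.2 (htraj.heta t ht)))
    (fun t ht h1 h2 => by
      obtain ⟨-, -, -, hω, hv1, hv2⟩ := hball (hnear (x t) (y t, η t) (hxnn t ht) h1 h2)
      refine ⟨hω, ?_⟩
      have hx := hxnn t ht
      refine max_le ((pi_norm_le_iff_of_nonneg hx).2 fun i => ?_)
        ((pi_norm_le_iff_of_nonneg hx).2 fun i => ?_)
      · have h3 := hv1 i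
        simp only at h3 ⊢
        rw [Real.norm_eq_abs, pow_two, mul_assoc, abs_mul (x t), abs_of_nonneg hx]
        exact mul_le_of_le_one_right hx h3
      · have h3 := hv2 i
        simp only at h3 ⊢
        rw [Real.norm_eq_abs, show -(1/2) * (x t)^2 * quadForm (dyA A i (x t) (y t)) (η t) (η t)
          = x t * (-(1/2) * (x t * quadForm (dyA A i (x t) (y t)) (η t) (η t))) by ring,
          abs_mul (x t), abs_of_nonneg hx, abs_mul (-(1/2))]
        refine mul_le_of_le_one_right hx ?_
        rw [abs_of_neg (by norm_num : (-(1/2) : ℝ) < 0)]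
        linarith)
    hxnn hx0 hξ0 (by simp [hy0, hη0])
  refine (intervalIntegral.intervalIntegral_pos_of_pos_on ?_ ?_ hT).ne' hzero
  · refine ContinuousOn.intervalIntegrable fun t ht => ContinuousAt.continuousWithinAt ?_
    rw [uIcc_of_le hT.le] at ht
    have hxc := (htraj.hx t ht).continuousAt
    have hyc := (hasDerivAt_pi.2 (htraj.hy t ht)).continuousAt
    have hηc := (hasDerivAt_pi.2 (htraj.heta t ht)).continuousAt
    have hWt := hWo.mem_nhds (hW (mk_mem_prod (htraj.mem t ht).1 (htraj.mem t ht).2))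
    have hcurve : ∀ g : ℝ → (Fin (n-1) → ℝ) → ℝ,
        ContDiffOn ℝ (⊤ : ℕ∞) (fun p : ℝ × (Fin (n-1) → ℝ) => g p.1 p.2) W →
        ContinuousAt (fun t => g (x t) (y t)) t := fun g hg =>
      (hg.continuousOn.continuousAt hWt).comp (f := fun t => (x t, y t)) (hxc.prodMk hyc)
    exact tendsto_finsetSum _ fun i _ => (hcurve _ (hG i)).mul ((hxc.pow 2).mul
      (continuousAt_matrix_apply (M := fun t => A (x t) (y t))
        (fun i j => hcurve (fun x y => A x y i j) (hA i j)) hηc i))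
  · intro t ht
    have ht' := Ioo_subset_Icc_self ht
    have hxt := hxpos t ht
    obtain ⟨hst1, hst2⟩ := hstay t ht'
    have hgood := fun (r : ℝ) (hr : r ∈ Icc 0 (x t)) =>
      hball (hnear r (y t, η t) hr.1 (hr.2.trans hst1) hst2)
    have hX : 0 < x t ^ k / (k.factorial : ℝ) := by positivity
    have htaylor : ∀ i, |G i (x t) (y t) / (x t ^ k / (k.factorial : ℝ)) - a i| ≤ e := by
      intro i
      have := abs_sub_monomial_le (X := x t) (a := a i) (e := e) k
        (fun j r => dxIter j (G i) r (y t))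
        (fun j r hr => hasDerivAt_dxIter hWo (hG i) j (hgood r hr).1)
        (fun j hj => hk j hj (y t) (htraj.mem t ht').2 i)
        (fun r hr => (hgood r hr).2.1 i) (x t) ⟨hxt.le, le_rfl⟩
      rw [div_sub' hX.ne', abs_div, abs_of_pos hX, div_le_iff₀ hX, mul_comm _ (a i)]
      exact this
    have hsum := hepos _ _ htaylor (hgood (x t) ⟨hxt.le, le_rfl⟩).2.2.1
    have hfac : ∑ i, G i (x t) (y t) * ((x t)^2 * ∑ j, A (x t) (y t) i j * η t j)
        = (x t ^ k / (k.factorial : ℝ)) * (x t)^2 *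
          ∑ i, G i (x t) (y t) / (x t ^ k / (k.factorial : ℝ))
            * ∑ j, A (x t) (y t) i j * η t j := by
      rw [Finset.mul_sum]
      refine Finset.sum_congr rfl fun i _ => ?_
      field_simp
    rw [hfac]
    exact mul_pos (by positivity) hsum

/-- high-order boundary vanishing modulo gauge: if the smooth one-form
`f = f₀ dx + Σᵢ fᵢ dyⁱ` has vanishing X-ray transform along all sufficiently short geodesics,
then there is a smooth potential `q` vanishing on the boundary such that `f − dq` vanishes to
infinite order at `x = 0`. -/
theorem stmt_14 (n : ℕ) (ε : ℝ) (U : Set (Fin (n-1) → ℝ))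
    (A : ℝ → (Fin (n-1) → ℝ) → Matrix (Fin (n-1)) (Fin (n-1)) ℝ) (lam Lam : ℝ)
    (hGG : GasGiantData n ε U A lam Lam)
    (f0 : ℝ → (Fin (n-1) → ℝ) → ℝ) (fT : Fin (n-1) → ℝ → (Fin (n-1) → ℝ) → ℝ)
    (hf : ∃ W : Set (ℝ × (Fin (n-1) → ℝ)), IsOpen W ∧ Set.Ico (0:ℝ) ε ×ˢ U ⊆ W ∧
      ContDiffOn ℝ (⊤ : ℕ∞) (fun p : ℝ × (Fin (n-1) → ℝ) => f0 p.1 p.2) W ∧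
      ∀ i, ContDiffOn ℝ (⊤ : ℕ∞) (fun p : ℝ × (Fin (n-1) → ℝ) => fT i p.1 p.2) W)
    (hmain : ∃ s₀ > (0:ℝ),
      (∀ y₀ ∈ U, ∀ η₀ : Fin (n-1) → ℝ, quadForm (A 0 y₀) η₀ η₀ = 1 →
        ∀ s ∈ Set.Ioo (0:ℝ) s₀,
          ∃ (T : ℝ) (x : ℝ → ℝ) (y : ℝ → Fin (n-1) → ℝ) (ξ : ℝ → ℝ)
            (η : ℝ → Fin (n-1) → ℝ), IsShortGeo n ε U A y₀ η₀ s T x y ξ η) ∧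
      (∀ y₀ ∈ U, ∀ η₀ : Fin (n-1) → ℝ, quadForm (A 0 y₀) η₀ η₀ = 1 →
        ∀ s ∈ Set.Ioo (0:ℝ) s₀,
        ∀ (T : ℝ) (x : ℝ → ℝ) (y : ℝ → Fin (n-1) → ℝ) (ξ : ℝ → ℝ)
          (η : ℝ → Fin (n-1) → ℝ),
          IsShortGeo n ε U A y₀ η₀ s T x y ξ η →
          (∫ t in (0:ℝ)..T, f0 (x t) (y t) * ξ t
              + ∑ i, fT i (x t) (y t) * ((x t)^2 * ∑ j, A (x t) (y t) i j * η t j)) = 0)) :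
    ∃ q : ℝ → (Fin (n-1) → ℝ) → ℝ,
      (∃ W : Set (ℝ × (Fin (n-1) → ℝ)), IsOpen W ∧ Set.Ico (0:ℝ) ε ×ˢ U ⊆ W ∧
        ContDiffOn ℝ (⊤ : ℕ∞) (fun p : ℝ × (Fin (n-1) → ℝ) => q p.1 p.2) W) ∧
      (∀ y ∈ U, q 0 y = 0) ∧
      (∀ (k : ℕ), ∀ y₀ ∈ U,
        dxIter k (fun x' y' => f0 x' y' - dxF q x' y') 0 y₀ = 0 ∧
        ∀ i, dxIter k (fun x' y' => fT i x' y' - dyF q i x' y') 0 y₀ = 0) := by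
  obtain ⟨WA, hWAo, hWA, hA⟩ := hGG.hsmooth
  obtain ⟨Wf, hWfo, hWf, hf0, hfT⟩ := hf
  obtain ⟨s₀, hs₀, hex, hint⟩ := hmain
  let q : ℝ → (Fin (n-1) → ℝ) → ℝ := fun x y => ∫ r in (0:ℝ)..x, f0 r y
  set Wq := horizontalCore Wf with hWq_def
  have hWqo : IsOpen Wq := isOpen_horizontalCore hWfo
  have hWq : Ico (0:ℝ) ε ×ˢ U ⊆ Wq := fun p hp r hr =>
    hWf ⟨⟨mul_nonneg hr.1 hp.1.1, (mul_le_of_le_one_left hp.1.1 hr.2).trans_lt hp.1.2⟩, hp.2⟩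
  have hWqf : Wq ⊆ Wf := fun p hp => by simpa using hp 1 (by simp)
  have hq : ContDiffOn ℝ (⊤ : ℕ∞) (fun p : ℝ × (Fin (n-1) → ℝ) => q p.1 p.2) Wq :=
    contDiffOn_horizontal_primitive hWfo hf0
  have hdxq : ∀ p ∈ Wq, dxF q p.1 p.2 = f0 p.1 p.2 := fun p hp =>
    (hasDerivAt_horizontal_primitive hWfo hf0.continuousOn hp).deriv
  have hG : ∀ i, ContDiffOn ℝ (⊤ : ℕ∞)
      (fun p : ℝ × (Fin (n-1) → ℝ) => fT i p.1 p.2 - dyF q i p.1 p.2) Wq := fun i =>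
    ((hfT i).mono hWqf).sub (contDiffOn_dyF hWqo hq i)
  have hq0 : ∀ y, q 0 y = 0 := fun y => by simp [q]
  have hint' : ∀ y₀ ∈ U, ∀ η₀ : Fin (n-1) → ℝ, quadForm (A 0 y₀) η₀ η₀ = 1 →
      ∀ s ∈ Set.Ioo (0:ℝ) s₀, ∀ (T : ℝ) (x : ℝ → ℝ) (y : ℝ → Fin (n-1) → ℝ) (ξ : ℝ → ℝ)
        (η : ℝ → Fin (n-1) → ℝ), IsShortGeo n ε U A y₀ η₀ s T x y ξ η →
        (∫ t in (0:ℝ)..T, ∑ i, (fT i (x t) (y t) - dyF q i (x t) (y t))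
          * ((x t)^2 * ∑ j, A (x t) (y t) i j * η t j)) = 0 := by
    intro y₀ hy₀ η₀ hη₀ s hs T x y ξ η hgeo
    have h0 := hint y₀ hy₀ η₀ hη₀ s hs T x y ξ η hgeo
    obtain ⟨hT, htraj, hx0, -, -, -, hxT, -⟩ := hgeo
    have hmemI : ∀ t ∈ Icc 0 T, (x t, y t) ∈ Ico (0:ℝ) ε ×ˢ U := fun t ht =>
      ⟨(htraj.mem t ht).1, (htraj.mem t ht).2⟩
    have hcurve : ∀ t ∈ Icc 0 T, ∀ {W : Set (ℝ × (Fin (n-1) → ℝ))}, IsOpen W →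
        Ico (0:ℝ) ε ×ˢ U ⊆ W → ∀ g : ℝ → (Fin (n-1) → ℝ) → ℝ,
        ContDiffOn ℝ (⊤ : ℕ∞) (fun p : ℝ × (Fin (n-1) → ℝ) => g p.1 p.2) W →
        ContinuousAt (fun t => g (x t) (y t)) t := fun t ht W hW hsub g hg =>
      (hg.continuousOn.continuousAt (hW.mem_nhds (hsub (hmemI t ht)))).comp
        (f := fun t => (x t, y t)) ((htraj.hx t ht).continuousAt.prodMk
          (hasDerivAt_pi.2 (htraj.hy t ht)).continuousAt)
    have hvel : ∀ t ∈ Icc 0 T, ∀ i,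
        ContinuousAt (fun t => (x t)^2 * ∑ j, A (x t) (y t) i j * η t j) t := fun t ht i =>
      ((htraj.hx t ht).continuousAt.pow 2).mul
        (continuousAt_matrix_apply (M := fun t => A (x t) (y t))
          (fun i j => hcurve t ht hWAo hWA (fun x y => A x y i j) (hA i j))
          (hasDerivAt_pi.2 (htraj.heta t ht)).continuousAt i)
    have hdq : ∀ t ∈ Icc 0 T, HasDerivAt (fun t => q (x t) (y t)) (f0 (x t) (y t) * ξ t
        + ∑ i, dyF q i (x t) (y t) * ((x t)^2 * ∑ j, A (x t) (y t) i j * η t j)) t := by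
      intro t ht
      rw [← hdxq _ (hWq (hmemI t ht))]
      exact hasDerivAt_along_curve hWqo hq (hWq (hmemI t ht)) (htraj.hx t ht) (htraj.hy t ht)
    have hi0 : IntervalIntegrable (fun t => f0 (x t) (y t) * ξ t
        + ∑ i, fT i (x t) (y t) * ((x t)^2 * ∑ j, A (x t) (y t) i j * η t j))
        MeasureTheory.volume 0 T := by
      refine ContinuousOn.intervalIntegrable fun t ht => ContinuousAt.continuousWithinAt ?_
      rw [uIcc_of_le hT.le] at ht
      exact ((hcurve t ht hWfo hWf _ hf0).mul (htraj.hxi t ht).continuousAt).add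
        (tendsto_finsetSum _ fun i _ => (hcurve t ht hWfo hWf _ (hfT i)).mul (hvel t ht i))
    have hi1 : IntervalIntegrable (fun t => f0 (x t) (y t) * ξ t
        + ∑ i, dyF q i (x t) (y t) * ((x t)^2 * ∑ j, A (x t) (y t) i j * η t j))
        MeasureTheory.volume 0 T := by
      refine ContinuousOn.intervalIntegrable fun t ht => ContinuousAt.continuousWithinAt ?_
      rw [uIcc_of_le hT.le] at ht
      exact ((hcurve t ht hWfo hWf _ hf0).mul (htraj.hxi t ht).continuousAt).add
        (tendsto_finsetSum _ fun i _ =>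
          (hcurve t ht hWqo hWq _ (contDiffOn_dyF hWqo hq i)).mul (hvel t ht i))
    have h1 := intervalIntegral.integral_eq_sub_of_hasDerivAt
      (fun t ht => hdq t (by rwa [uIcc_of_le hT.le] at ht)) hi1
    rw [hx0, hxT, hq0, hq0, sub_zero] at h1
    have h2 := intervalIntegral.integral_sub hi0 hi1
    rw [h0, h1, sub_zero] at h2
    refine Eq.trans (intervalIntegral.integral_congr fun t _ => ?_) h2
    simp only [sub_mul, Finset.sum_sub_distrib]
    ring
  have hmem0 : ∀ y ∈ U, ((0:ℝ), y) ∈ Ico (0:ℝ) ε ×ˢ U := fun y hy => ⟨⟨le_rfl, hGG.hε.1⟩, hy⟩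
  have hvanish : ∀ k, ∀ y ∈ U, ∀ i,
      dxIter k (fun x' y' => fT i x' y' - dyF q i x' y') 0 y = 0 := by
    intro k
    induction k using Nat.strong_induction_on with
    | _ k ih =>
      intro y hy i
      exact dxIter_eq_zero_of_xray_eq_zero (W := WA ∩ Wq)
        (G := fun i x' y' => fT i x' y' - dyF q i x' y') hGG (hWAo.inter hWqo)
        (subset_inter hWA hWq) (fun i j => (hA i j).mono inter_subset_left)
        (fun i => (hG i).mono inter_subset_right) hs₀ hex hint' ih hy i
  refine ⟨q, ⟨Wq, hWqo, hWq, hq⟩, fun y _ => hq0 y, fun k y hy => ⟨?_, hvanish k y hy⟩⟩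
  exact dxIter_eq_zero_of_eqOn (g := fun x' y' => f0 x' y' - dxF q x' y') hWqo
    (fun p hp => by rw [hdxq p hp, sub_self]) k (0, y) (hWq (hmem0 y hy))
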